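/- For every finite simple graph G, if m denotes the number of edges of G and Δ(G) denotes the number of triangles of G (i.e. the number of 3-element vertex sets spanning a complete subgraph), then Δ(G) ≤ m^{3/2}. -/

import Mathlib

theorem tri_repr {V : Type*} [DecidableEq V] (G : SimpleGraph V) {s : Finset V}
    (hs : G.IsNClique 3 s) {v : V} (hv : v ∈ s) :
    ∃ a b, G.Adj v a ∧ G.Adj v b ∧ G.Adj a b ∧ s = {v, a, b} := by
  obtain ⟨x, y, z, hxy, hxz, hyz, rfl⟩ := SimpleGraph.is3Clique_iff.1 hs
  simp only [Finset.mem_insert, Finset.mem_singleton] at hv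
  rcases hv with rfl | rfl | rfl
  · exact ⟨y, z, hxy, hxz, hyz, rfl⟩
  · exact ⟨x, z, hxy.symm, hyz, hxz, by ext; simp; tauto⟩
  · exact ⟨x, y, hxz.symm, hyz.symm, hxy, by ext; simp; tauto⟩

theorem stmt_12 {V : Type*} [Fintype V] [DecidableEq V]
    (G : SimpleGraph V) [DecidableRel G.Adj] :
    ((G.cliqueFinset 3).card : ℝ) ≤ (G.edgeFinset.card : ℝ) ^ ((3 : ℝ) / 2) := by
  have h3 : ∑ v, ((G.cliqueFinset 3).filter (fun s => v ∈ s)).card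
      = 3 * (G.cliqueFinset 3).card := by
    have := Finset.sum_card_bipartiteAbove_eq_sum_card_bipartiteBelow
      (s := (Finset.univ : Finset V)) (t := G.cliqueFinset 3) (fun v s => v ∈ s)
    simp only [Finset.bipartiteAbove, Finset.bipartiteBelow] at this
    rw [this, Finset.sum_congr rfl (g := fun _ => 3)]
    · simp [mul_comm]
    · intro s hs
      have := (G.mem_cliqueFinset_iff.1 hs).card_eq
      simpa using this
  have h1 : ∀ v, ((G.cliqueFinset 3).filter (fun s => v ∈ s)).card ≤ G.edgeFinset.card := by
    intro v
    refine le_trans (Finset.card_le_card (t := G.edgeFinset.image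
      (fun e => insert v e.toFinset)) ?_) Finset.card_image_le
    intro s hs
    rw [Finset.mem_filter, G.mem_cliqueFinset_iff] at hs
    obtain ⟨a, b, ha, hb, hab, rfl⟩ := tri_repr G hs.1 hs.2
    refine Finset.mem_image.2 ⟨s(a, b), by simpa using hab, ?_⟩
    ext; simp
  have h2 : ∀ v, ((G.cliqueFinset 3).filter (fun s => v ∈ s)).card
      ≤ G.degree v * G.degree v := by
    intro v
    rw [← G.card_neighborFinset_eq_degree, ← Finset.card_product]
    refine le_trans (Finset.card_le_card (t := (G.neighborFinset v ×ˢ G.neighborFinset v).image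
      (fun p => {v, p.1, p.2})) ?_) Finset.card_image_le
    intro s hs
    rw [Finset.mem_filter, G.mem_cliqueFinset_iff] at hs
    obtain ⟨a, b, ha, hb, hab, rfl⟩ := tri_repr G hs.1 hs.2
    exact Finset.mem_image.2 ⟨(a, b), by simp [ha, hb], rfl⟩
  have hd := G.sum_degrees_eq_twice_card_edges
  have h4 : ∀ v, (((G.cliqueFinset 3).filter (fun s => v ∈ s)).card : ℝ)
      ≤ √(G.edgeFinset.card : ℝ) * G.degree v := by
    intro v
    have a : (((G.cliqueFinset 3).filter (fun s => v ∈ s)).card : ℝ) ≤ G.edgeFinset.card := by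
      exact_mod_cast h1 v
    have b : (((G.cliqueFinset 3).filter (fun s => v ∈ s)).card : ℝ)
      ≤ G.degree v * G.degree v := by exact_mod_cast h2 v
    refine abs_le_of_sq_le_sq' ?_ (by positivity) |>.2
    rw [mul_pow, Real.sq_sqrt (by positivity), sq, sq]
    exact mul_le_mul a b (by positivity) (by positivity)
  have h5 := Finset.sum_le_sum (fun v (_ : v ∈ Finset.univ) => h4 v)
  rw [← Finset.mul_sum, ← Nat.cast_sum, ← Nat.cast_sum, h3, hd] at h5
  push_cast at h5
  have h6 : (G.edgeFinset.card : ℝ) ^ ((3 : ℝ) / 2)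
      = √(G.edgeFinset.card : ℝ) * G.edgeFinset.card := by
    rw [Real.sqrt_eq_rpow, show (3 : ℝ) / 2 = 1 / 2 + 1 by norm_num,
      Real.rpow_add_one' (by positivity) (by norm_num)]
  rw [h6]
  have : 0 ≤ √(G.edgeFinset.card : ℝ) * G.edgeFinset.card := by positivity
  linarith
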